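/- (Monotonicity of the GOWA robust objective, Theorem 3.4.) Let 𝒳 ⊆ ℝ be nonempty. Suppose each of the functions f_1, …, f_p : ℝ → ℝ is monotone increasing on 𝒳 and f_j(x) ≥ 0 for all x ∈ 𝒳 and all j. Then for every λ > 0 and every choice of weights w_1, …, w_p ≥ 0 with ∑_{i=1}^p w_i = 1, the GOWA robust objective function φ is monotone increasing on 𝒳. -/

import Mathlib

/- The `i`-th largest element (0-indexed) of a multiset of reals, counted with
multiplicity; junk value `0` if `i` is out of range. -/
open Classical in
noncomputable def orderStatM (s : Multiset ℝ) (i : ℕ) : ℝ :=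
  (s.sort (· ≤ ·)).getD (Multiset.card s - 1 - i) 0

/-- `orderStat v i` is the `i`-th largest value (0-indexed) among `v 0, …, v (p-1)`,
counted with multiplicity; it is the order statistic `s_{i+1}` of the paper, so that
`orderStat v 0 ≥ orderStat v 1 ≥ ⋯ ≥ orderStat v (p-1)`. -/
noncomputable def orderStat {p : ℕ} (v : Fin p → ℝ) (i : Fin p) : ℝ :=
  orderStatM (Finset.univ.val.map v) i.val

/-- The GOWA aggregation `φ` applied to the values `v j = f_j(x)`:
`φ = (∑ i, w i * (s_i)^λ)^(1/λ)` (real powers). -/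
noncomputable def gowa {p : ℕ} (w : Fin p → ℝ) (lam : ℝ) (v : Fin p → ℝ) : ℝ :=
  (∑ i : Fin p, w i * (orderStat v i) ^ lam) ^ (1 / lam)

theorem orderStat_eq_comp_sort {p : ℕ} (v : Fin p → ℝ) (i : Fin p) :
    orderStat v i = v (Tuple.sort v i.rev) := by
  classical
  have hs : (Finset.univ.val.map v).sort (· ≤ ·) = List.ofFn (v ∘ Tuple.sort v) := by
    refine List.Perm.eq_of_pairwise' (r := (· ≤ ·)) (Multiset.pairwise_sort _ _)
      (Tuple.monotone_sort v).sortedLE_ofFn.pairwise ?_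
    rw [← Multiset.coe_eq_coe, Multiset.sort_eq]
    refine Eq.trans ?_ (Multiset.coe_eq_coe.2 (Equiv.Perm.ofFn_comp_perm _ v)).symm
    rw [Fin.univ_val_map]
  have hi : p - 1 - i.val < p := by omega
  unfold orderStat orderStatM
  rw [hs, Multiset.card_map, Finset.card_val, Finset.card_univ, Fintype.card_fin,
    List.getD_eq_getElem _ _ (by simpa using hi), List.getElem_ofFn]
  have : (⟨p - 1 - i.val, hi⟩ : Fin p) = i.rev := by ext; simp [Fin.rev]; omega
  simp [this]

theorem orderStat_mono {p : ℕ} {u v : Fin p → ℝ} (h : u ≤ v) (i : Fin p) :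
    orderStat u i ≤ orderStat v i := by
  have card_comp (g : Fin p → ℝ) (a : ℝ) :
      (Finset.univ.filter fun j => (g ∘ Tuple.sort g) j ≤ a).card =
        (Finset.univ.filter fun j => g j ≤ a).card :=
    Finset.card_equiv (Tuple.sort g) (by simp)
  rw [orderStat_eq_comp_sort, orderStat_eq_comp_sort]
  set a := v (Tuple.sort v i.rev)
  refine (Tuple.lt_card_le_iff_apply_le_of_monotone (Tuple.monotone_sort u)).1 ?_
  have hv := (Tuple.lt_card_le_iff_apply_le_of_monotone (j := i.rev) (a := a)
    (Tuple.monotone_sort v)).2 le_rfl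
  rw [card_comp] at hv ⊢
  exact hv.trans_le
    (Finset.card_le_card (Finset.monotone_filter_right _ fun j _ hj => (h j).trans hj))

theorem orderStat_nonneg {p : ℕ} {v : Fin p → ℝ} (h : ∀ j, 0 ≤ v j) (i : Fin p) :
    0 ≤ orderStat v i := by
  rw [orderStat_eq_comp_sort]
  exact h _

/-- Theorem 3.4: monotonicity of the GOWA robust objective `φ` on `𝒳 ⊆ ℝ`. -/
theorem gowa_monotoneOn {p : ℕ} (hp : 1 ≤ p)
    (f : Fin p → ℝ → ℝ) (X : Set ℝ) (hX : X.Nonempty)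
    (hf : ∀ j, MonotoneOn (f j) X)
    (hf0 : ∀ j, ∀ x ∈ X, 0 ≤ f j x)
    (lam : ℝ) (hlam : 0 < lam)
    (w : Fin p → ℝ) (hw : ∀ i, 0 ≤ w i) (hw1 : ∑ i, w i = 1) :
    MonotoneOn (fun x => gowa w lam (fun j => f j x)) X := by
  intro x hx y hy hxy
  have nonneg (i : Fin p) : 0 ≤ orderStat (fun j => f j x) i :=
    orderStat_nonneg (fun j => hf0 j x hx) i
  have le (i : Fin p) : orderStat (fun j => f j x) i ≤ orderStat (fun j => f j y) i :=
    orderStat_mono (fun j => hf j hx hy hxy) i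
  refine Real.rpow_le_rpow
    (Finset.sum_nonneg fun i _ => mul_nonneg (hw i) (Real.rpow_nonneg (nonneg i) _))
    (Finset.sum_le_sum fun i _ => ?_) (one_div_nonneg.2 hlam.le)
  exact mul_le_mul_of_nonneg_left (Real.rpow_le_rpow (nonneg i) (le i) hlam.le) (hw i)
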